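/- In a multi-unit auction with unit demand, if an anonymous linear non-deficit Groves mechanism (given by r(θ_{-i}) = a_0 + Σ_{j=1}^{n−1} a_j·[θ_{-i}]_j) is individually undominated among non-deficit Groves mechanisms, then it is an OEL mechanism: there exists an integer k with 0 ≤ k ≤ n and k − m odd such that its coefficients (a_0,…,a_{n−1}) equal the coefficients of the OEL mechanism with index k. -/

import Mathlib

/-!
STATEMENT 13: Multi-unit auction with unit demand: n+1 ≥ 2 agents, m units
with 1 ≤ m ≤ n, types in [L,U] with 0 ≤ L < U. If an anonymous linear
non-deficit Groves mechanism, given by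
r(θ_{-i}) = a₀ + Σ_{j=1}^{n} a_j·[θ_{-i}]_j, is individually undominated
among non-deficit Groves mechanisms, then it is an OEL mechanism: there is
an integer k with 0 ≤ k ≤ n+1 and k − m odd (equivalently k + m odd) such
that its coefficients a₀, …, a_n equal the coefficients of the OEL mechanism
with index k.

Encoding: `kthTop x j` is the (j+1)-th highest coordinate of x (0-based j),
so the paper's [x]_j is `kthTop x (j-1)`; the total VCG payment is
m·[θ]_{m+1} = m·kthTop θ m. `oelCoeff N m k L U i` is the paper's
coefficient c_i for an auction with N agents, and the OEL redistribution of
the paper, r(x) = c₀ + Σ_{j=1}^{N−1} c_j [x]_j, is `oelR`. A Groves mechanism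
is a family r : Fin (n+1) → ([L,U]^n → ℝ) and θ_{-i} = θ ∘ i.succAbove;
non-deficit means Σ_i r_i(θ_{-i}) ≤ m·[θ]_{m+1} on the box [L,U]^{n+1}.
-/

/-- The (j+1)-th highest coordinate of the tuple `x` (`j` 0-based). -/
noncomputable def kthTop {N : ℕ} (x : Fin N → ℝ) (j : Fin N) : ℝ :=
  x (Tuple.sort x j.rev)

/-- (−1)^{m−i}·C(N−i−1, N−m−1)/C(m−1, i−1), for 1 ≤ i ≤ m. -/
noncomputable def oelA (N m i : ℕ) : ℝ :=
  (-1 : ℝ) ^ (m - i) * ((N - i - 1).choose (N - m - 1) : ℝ) /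
    ((m - 1).choose (i - 1) : ℝ)

/-- (−1)^{m−i−1}·C(i−1, m−1)/C(N−m−1, N−i−1), for m+1 ≤ i ≤ N−1
(the parity of m−i−1 equals that of i−m−1, which is used since i > m). -/
noncomputable def oelB (N m i : ℕ) : ℝ :=
  (-1 : ℝ) ^ (i - m - 1) * ((i - 1).choose (m - 1) : ℝ) /
    ((N - m - 1).choose (N - i - 1) : ℝ)

/-- The OEL coefficients c_0, …, c_{N−1} for index k, with N agents. -/
noncomputable def oelCoeff (N m k : ℕ) (L U : ℝ) : ℕ → ℝ := fun i =>
  if k = 0 then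
    if i = 0 then U * m / N - U * ∑ j ∈ Finset.Icc 1 m, oelA N m j
    else if i ≤ m then oelA N m i
    else 0
  else if k ≤ m then
    if i = k then (m : ℝ) / N - ∑ j ∈ Finset.Icc (k+1) m, oelA N m j
    else if k + 1 ≤ i ∧ i ≤ m then oelA N m i
    else 0
  else if k ≤ N - 1 then
    if i = k then (m : ℝ) / N - ∑ j ∈ Finset.Icc (m+1) (k-1), oelB N m j
    else if m + 1 ≤ i ∧ i ≤ k - 1 then oelB N m i
    else 0
  else
    if i = 0 then L * m / N - L * ∑ j ∈ Finset.Icc (m+1) (N-1), oelB N m j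
    else if m + 1 ≤ i ∧ i ≤ N - 1 then oelB N m i
    else 0

/-- The OEL redistribution function (for one of the n+1 agents, as a function
of the n types of the others): r(x) = c₀ + Σ_{j=1}^{n} c_j·[x]_j. -/
noncomputable def oelR (n m k : ℕ) (L U : ℝ) (x : Fin n → ℝ) : ℝ :=
  oelCoeff (n+1) m k L U 0 +
    ∑ j : Fin n, oelCoeff (n+1) m k L U (j.1 + 1) * kthTop x j


lemma kthTop_perm {N : ℕ} (x : Fin N → ℝ) (e : Equiv.Perm (Fin N)) (j : Fin N) :
    kthTop (x ∘ e) j = kthTop x j := by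
  have := congrFun (Tuple.comp_perm_comp_sort_eq_comp_sort (f := x) (σ := e)) j.rev
  simpa [kthTop] using this

lemma kthTop_antitone {N : ℕ} (x : Fin N → ℝ) (hx : Antitone x) (j : Fin N) :
    kthTop x j = x j := by
  rw [← kthTop_perm x Fin.revPerm j]
  have hm : Monotone (x ∘ (Fin.revPerm : Equiv.Perm (Fin N))) := by
    intro a b hab
    exact hx (Fin.rev_le_rev.mpr hab)
  have h := Tuple.sort_eq_refl_iff_monotone.mpr hm
  simp [kthTop, h]

lemma exists_sort {n : ℕ} (θ : Fin (n+1) → ℝ) :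
    ∃ π : Equiv.Perm (Fin (n+1)), (∀ j, kthTop θ j = θ (π j)) ∧ Antitone (fun j => θ (π j)) ∧
      ∀ i j, kthTop (θ ∘ (π i).succAbove) j = θ (π (i.succAbove j)) := by
  refine ⟨(Fin.revPerm : Equiv.Perm (Fin (n+1))).trans (Tuple.sort θ), fun j => rfl, ?_, ?_⟩
  · intro a b hab
    exact Tuple.monotone_sort θ (Fin.rev_le_rev.mpr hab)
  · have hanti : Antitone (fun j => θ (((Fin.revPerm : Equiv.Perm (Fin (n+1))).trans
        (Tuple.sort θ)) j)) := by
      intro a b hab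
      exact Tuple.monotone_sort θ (Fin.rev_le_rev.mpr hab)
    generalize (Fin.revPerm : Equiv.Perm (Fin (n+1))).trans (Tuple.sort θ) = π at *
    intro i j
    let e : Equiv.Perm (Fin n) := (finSuccAboveEquiv i).trans
      ((π.subtypeEquiv (fun a => by simp)).trans (finSuccAboveEquiv (π i)).symm)
    have he : (θ ∘ (π i).succAbove) ∘ e = fun j => θ (π (i.succAbove j)) := by
      funext j
      have : ∀ y, ((finSuccAboveEquiv (π i)) y : Fin (n+1)) = (π i).succAbove y := fun y => rfl
      simp only [Function.comp, e, Equiv.trans_apply, ← this, Equiv.apply_symm_apply]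
      rfl
    rw [← kthTop_perm _ e, he, kthTop_antitone]
    intro a b hab
    exact hanti ((Fin.strictMono_succAbove i).monotone hab)

lemma sum_succAbove {n : ℕ} (φ : Fin (n+1) → ℝ) (j : Fin n) :
    ∑ i : Fin (n+1), φ (i.succAbove j) = (j.1+1) * φ j.succ + (n - j.1) * φ j.castSucc := by
  have h1 : ∀ i : Fin (n+1), φ (i.succAbove j) =
      (if i ∈ Finset.Iic j.castSucc then (φ j.succ - φ j.castSucc) else 0) + φ j.castSucc := by
    intro i
    simp only [Finset.mem_Iic, Fin.succAbove]
    by_cases h : j.castSucc < i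
    · simp [h]
    · simp [h, not_lt.mp h]
  simp only [h1, Finset.sum_add_distrib, Finset.sum_ite_mem, Finset.univ_inter, Finset.sum_const,
    Fin.card_Iic, Finset.card_univ, Fintype.card_fin]
  simp
  ring

/-- Sum of redistributions in terms of the sorted profile. -/
noncomputable def Fsum (n : ℕ) (a : ℕ → ℝ) (φ : ℕ → ℝ) : ℝ :=
  (n+1) * a 0 + ∑ j ∈ Finset.range n, a (j+1) * ((j+1) * φ (j+1) + (n - j) * φ j)

lemma sum_rlin {n : ℕ} (a : ℕ → ℝ) (rlin : (Fin n → ℝ) → ℝ)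
    (hrlin : ∀ x : Fin n → ℝ,
      rlin x = a 0 + ∑ j : Fin n, a (j.1 + 1) * kthTop x j) (θ : Fin (n+1) → ℝ) (φ : ℕ → ℝ)
    (hφ : ∀ j : Fin (n+1), φ j = kthTop θ j) :
    ∑ i : Fin (n+1), rlin (θ ∘ i.succAbove) = Fsum n a φ := by
  obtain ⟨π, h1, h2, h3⟩ := exists_sort θ
  rw [← Equiv.sum_comp π]
  simp only [hrlin, h3, Finset.sum_add_distrib]
  rw [Finset.sum_comm]
  simp only [← Finset.mul_sum]
  have := fun j => sum_succAbove (fun i => θ (π i)) j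
  simp only [this]
  simp only [Fsum, Finset.sum_range, ← h1, ← hφ]
  simp

/-- Slack at the vertex with `s` types at `U`. -/
noncomputable def Sl (n m : ℕ) (L U : ℝ) (a : ℕ → ℝ) (s : ℕ) : ℝ :=
  m * (if m < s then U else L) - Fsum n a (fun j => if j < s then U else L)

lemma layer (N : ℕ) (ψ : ℕ → ℝ) (L U : ℝ) (h0 : ψ 0 = U) (hN : ψ (N+1) = L) (j : ℕ) (hj : j < N) :
    ∑ s ∈ Finset.range (N+1), (ψ s - ψ (s+1)) * (if j < s then U else L) = (U - L) * ψ (j+1) := by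
  have key : ∀ M, ∑ s ∈ Finset.range M, (ψ s - ψ (s+1)) * (if j < s then U else L) =
      if j < M then L * (ψ 0 - ψ (j+1)) + U * (ψ (j+1) - ψ M) else L * (ψ 0 - ψ M) := by
    intro M
    induction M with
    | zero => simp
    | succ M ih =>
      rw [Finset.sum_range_succ, ih]
      rcases lt_trichotomy j M with h | h | h
      · simp [h, Nat.lt_succ_of_lt h]; ring
      · subst h; simp; ring
      · simp [not_lt.mpr h.le, show ¬ (j < M+1) by omega]; ring
  rw [key, if_pos (by omega), h0, hN]; ring

lemma layer_slack (n m : ℕ) (hmn : m ≤ n) (ψ : ℕ → ℝ) (L U : ℝ) (a : ℕ → ℝ)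
    (h0 : ψ 0 = U) (hN : ψ (n+2) = L) :
    ∑ s ∈ Finset.range (n+2), (ψ s - ψ (s+1)) * Sl n m L U a s =
      (U - L) * (m * ψ (m+1) - Fsum n a (fun j => ψ (j+1))) := by
  have hl := layer (n+1) ψ L U h0 hN
  have hc : ∑ s ∈ Finset.range (n+2), (ψ s - ψ (s+1)) = U - L := by
    rw [Finset.sum_range_sub', h0, hN]
  have hF : ∑ s ∈ Finset.range (n+2), (ψ s - ψ (s+1)) * Fsum n a (fun j => if j < s then U else L)
      = (U - L) * Fsum n a (fun j => ψ (j+1)) := by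
    unfold Fsum
    simp only [mul_add, Finset.sum_add_distrib, ← Finset.sum_mul, hc, Finset.mul_sum]
    congr 1
    rw [Finset.sum_comm (s := Finset.range (n+2)), Finset.sum_comm (s := Finset.range (n+2)),
      ← Finset.sum_add_distrib, ← Finset.sum_add_distrib]
    refine Finset.sum_congr rfl fun j hj => ?_
    have hj' := Finset.mem_range.mp hj
    have e1 := hl (j+1) (by omega)
    have e2 := hl j (by omega)
    rw [show (U - L) * (a (j+1) * ((j+1) * ψ (j+1+1))) = a (j+1) * (j+1) * ((U-L) * ψ (j+1+1)) by ring,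
      show (U - L) * (a (j+1) * ((n-j) * ψ (j+1))) = a (j+1) * (n-j) * ((U-L) * ψ (j+1)) by ring,
      ← e1, ← e2, Finset.mul_sum, Finset.mul_sum]
    congr 1 <;> exact Finset.sum_congr rfl fun s _ => by ring
  simp only [Sl, mul_sub, Finset.sum_sub_distrib] at *
  rw [hF]
  have := hl m (by omega)
  rw [show (∑ x ∈ Finset.range (n+2), (ψ x - ψ (x+1)) * ((m:ℝ) * if m < x then U else L)) =
    m * ∑ s ∈ Finset.range (n+2), (ψ s - ψ (s+1)) * (if m < s then U else L) by
      rw [Finset.mul_sum]; exact Finset.sum_congr rfl fun s _ => by ring]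
  rw [this]; ring

lemma Sl_nonneg {n m : ℕ} (hmn : m ≤ n)
    {L U : ℝ} (hLU : L < U) (a : ℕ → ℝ) (rlin : (Fin n → ℝ) → ℝ)
    (hrlin : ∀ x : Fin n → ℝ,
      rlin x = a 0 + ∑ j : Fin n, a (j.1 + 1) * kthTop x j)
    (hnd : ∀ θ : Fin (n+1) → ℝ, (∀ i, θ i ∈ Set.Icc L U) →
      ∑ i : Fin (n+1), rlin (θ ∘ i.succAbove) ≤ m * kthTop θ ⟨m, Nat.lt_succ_of_le hmn⟩) (s : ℕ) :
    0 ≤ Sl n m L U a s := by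
  let θ : Fin (n+1) → ℝ := fun j => if j.1 < s then U else L
  have hanti : Antitone θ := by
    intro i j hij
    have : i.1 ≤ j.1 := hij
    simp only [θ]
    split_ifs <;> linarith
  have h := hnd θ (by
    intro i
    simp only [θ]
    split_ifs
    · exact ⟨hLU.le, le_rfl⟩
    · exact ⟨le_rfl, hLU.le⟩)
  rw [sum_rlin a rlin hrlin θ (fun j => if j < s then U else L)
    (fun j => (kthTop_antitone θ hanti j).symm), kthTop_antitone θ hanti] at h
  simp only [θ] at h
  unfold Sl
  linarith

lemma tight_pair {n m : ℕ} (hmn : m ≤ n)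
    {L U : ℝ} (hLU : L < U) (a : ℕ → ℝ) (rlin : (Fin n → ℝ) → ℝ)
    (hrlin : ∀ x : Fin n → ℝ,
      rlin x = a 0 + ∑ j : Fin n, a (j.1 + 1) * kthTop x j)
    (hS : ∀ s, 0 ≤ Sl n m L U a s) (p q : ℕ) (hpq : p < q) (hq : q ≤ n + 1)
    (hp0 : 0 < Sl n m L U a p) (hq0 : 0 < Sl n m L U a q) :
    ∃ ε > 0, ∃ x : Fin n → ℝ, (∀ j, x j ∈ Set.Icc L U) ∧
      ∀ θ : Fin (n+1) → ℝ, (∀ i, θ i ∈ Set.Icc L U) → θ ∘ (0 : Fin (n+1)).succAbove = x →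
        ∑ i : Fin (n+1), rlin (θ ∘ i.succAbove) + ε ≤ m * kthTop θ ⟨m, Nat.lt_succ_of_le hmn⟩ := by
  obtain ⟨δ, hδ⟩ : ∃ δ : ℝ, δ = (U - L) / (n+1) := ⟨_, rfl⟩
  have hn0 : (0:ℝ) < n + 1 := by positivity
  have hδ0 : 0 < δ := by rw [hδ]; exact div_pos (by linarith) hn0
  have hδN : (n+1) * δ = U - L := by rw [hδ]; field_simp
  let c := min (Sl n m L U a p) (Sl n m L U a q)
  have hc0 : 0 < c := lt_min hp0 hq0
  let x : Fin n → ℝ := fun j => U - (j.1 + 1) * δ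
  have hxanti : Antitone x := by
    intro i j hij
    have : (i.1:ℝ) ≤ j.1 := by exact_mod_cast hij
    simp only [x]
    nlinarith
  refine ⟨δ * c / (U - L), div_pos (mul_pos hδ0 hc0) (by linarith), x, ?_, ?_⟩
  · intro j
    have : (j.1:ℝ) + 1 ≤ n := by exact_mod_cast j.2
    simp only [x]
    constructor
    · nlinarith
    · have : (0:ℝ) ≤ (j.1 + 1) * δ := by positivity
      linarith
  intro θ hθ hx
  obtain ⟨π, h1, h2, h3⟩ := exists_sort θ
  obtain ⟨i, hi⟩ := π.surjective 0
  have h4 : ∀ j : Fin n, θ (π (i.succAbove j)) = U - (j.1 + 1) * δ := by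
    intro j
    rw [← h3, hi, hx, kthTop_antitone x hxanti]
  let ψ : ℕ → ℝ := fun s => if s = 0 then U else if h : s - 1 < n + 1 then kthTop θ ⟨s-1, h⟩ else L
  have hψ0 : ψ 0 = U := by simp [ψ]
  have hψN : ψ (n+2) = L := by simp [ψ]
  have hψ : ∀ j : Fin (n+1), ψ (j.1+1) = kthTop θ j := by
    intro j
    simp [ψ]
    intro h
    omega
  have hlow : ∀ s, s ≤ i.1 → ψ s = U - s * δ := by
    intro s hs
    rcases s with _ | s
    · simp [hψ0]
    · have e : i.succAbove ⟨s, by omega⟩ = ⟨s, by omega⟩ := by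
        rw [Fin.succAbove_of_castSucc_lt _ _ (by rw [Fin.lt_def]; simp; omega)]
        rfl
      have := h4 ⟨s, by omega⟩
      rw [e, ← h1, ← hψ] at this
      simpa using this
  have hhigh : ∀ s, i.1 + 1 ≤ s → s ≤ n + 1 → ψ (s+1) = U - s * δ := by
    intro s hs hs2
    rcases Nat.lt_or_ge s (n+1) with h | h
    · obtain ⟨t, rfl⟩ : ∃ t, s = t + 1 := ⟨s - 1, by omega⟩
      have e : i.succAbove ⟨t, by omega⟩ = ⟨t+1, by omega⟩ := by
        rw [Fin.succAbove_of_le_castSucc _ _ (by rw [Fin.le_def]; simp; omega)]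
        rfl
      have := h4 ⟨t, by omega⟩
      rw [e, ← h1, ← hψ] at this
      simpa using this
    · obtain rfl : s = n + 1 := by omega
      rw [hψN]; push_cast; linarith
  have hmono : ∀ s, s ≤ n + 1 → 0 ≤ ψ s - ψ (s+1) := by
    intro s hs
    rcases s with _ | s
    · have e := hψ 0
      have := (hθ (π 0)).2
      rw [hψ0]
      simp only [h1, Fin.val_zero] at e
      rw [e]; linarith
    · have e := hψ ⟨s, by omega⟩
      simp only at e
      rcases Nat.lt_or_ge s n with h | h
      · have e2 := hψ ⟨s+1, by omega⟩
        simp only at e2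
        rw [e, e2, h1, h1]
        have := h2 (show (⟨s, by omega⟩ : Fin (n+1)) ≤ ⟨s+1, by omega⟩ by
          rw [Fin.le_def]; simp)
        simp only at this
        linarith
      · obtain rfl : s = n := by omega
        rw [hψN, e, h1]
        have := (hθ (π ⟨s, by omega⟩)).1
        linarith
  have hw : δ ≤ (ψ p - ψ (p+1)) + (ψ q - ψ (q+1)) := by
    have hp' := hmono p (by omega)
    have hq' := hmono q hq
    rcases Nat.lt_or_ge p i.1 with h | h
    · have e1 := hlow p h.le
      have e2 := hlow (p+1) h
      push_cast at e2
      linarith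
    rcases Nat.lt_or_ge (i.1+1) q with h' | h'
    · obtain ⟨t, rfl⟩ : ∃ t, q = t + 1 := ⟨q - 1, by omega⟩
      have e1 := hhigh t (by omega) (by omega)
      have e2 := hhigh (t+1) (by omega) hq
      push_cast at e2
      linarith
    · obtain rfl : q = p + 1 := by omega
      have e1 := hlow p (by omega)
      have e2 := hhigh (p+1) (by omega) hq
      push_cast at e2
      linarith
  have hls := layer_slack n m hmn ψ L U a hψ0 hψN
  have hsum : (ψ p - ψ (p+1)) * Sl n m L U a p + (ψ q - ψ (q+1)) * Sl n m L U a q ≤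
      ∑ s ∈ Finset.range (n+2), (ψ s - ψ (s+1)) * Sl n m L U a s := by
    rw [← Finset.sum_pair (f := fun s => (ψ s - ψ (s+1)) * Sl n m L U a s) hpq.ne]
    apply Finset.sum_le_sum_of_subset_of_nonneg
    · intro s hs
      simp only [Finset.mem_insert, Finset.mem_singleton] at hs
      rw [Finset.mem_range]; omega
    · intro s hs _
      exact mul_nonneg (hmono s (by rw [Finset.mem_range] at hs; omega)) (hS s)
  have hb : δ * c ≤ (ψ p - ψ (p+1)) * Sl n m L U a p + (ψ q - ψ (q+1)) * Sl n m L U a q := by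
    have b1 := mul_le_mul_of_nonneg_left (min_le_left (Sl n m L U a p) (Sl n m L U a q))
      (hmono p (by omega))
    have b2 := mul_le_mul_of_nonneg_left (min_le_right (Sl n m L U a p) (Sl n m L U a q))
      (hmono q hq)
    have b3 := mul_le_mul_of_nonneg_right hw hc0.le
    simp only [c] at *
    linarith
  rw [sum_rlin a rlin hrlin θ (fun j => ψ (j+1)) hψ, ← hψ]
  have hUL : 0 < U - L := by linarith
  have : δ * c / (U - L) ≤ m * ψ (m+1) - Fsum n a (fun j => ψ (j+1)) := by
    rw [div_le_iff₀ hUL]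
    linarith
  linarith

lemma tight_except {n m : ℕ} (hmn : m ≤ n)
    {L U : ℝ} (hLU : L < U)
    (a : ℕ → ℝ)
    (rlin : (Fin n → ℝ) → ℝ)
    (hrlin : ∀ x : Fin n → ℝ,
      rlin x = a 0 + ∑ j : Fin n, a (j.1 + 1) * kthTop x j)
    (hnd : ∀ θ : Fin (n+1) → ℝ, (∀ i, θ i ∈ Set.Icc L U) →
      ∑ i : Fin (n+1), rlin (θ ∘ i.succAbove) ≤ m * kthTop θ ⟨m, Nat.lt_succ_of_le hmn⟩)
    (hundom : ¬ ∃ r' : Fin (n+1) → (Fin n → ℝ) → ℝ,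
      (∀ θ : Fin (n+1) → ℝ, (∀ i, θ i ∈ Set.Icc L U) →
        ∑ i : Fin (n+1), r' i (θ ∘ i.succAbove) ≤ m * kthTop θ ⟨m, Nat.lt_succ_of_le hmn⟩) ∧
      (∀ (i : Fin (n+1)) (θ : Fin (n+1) → ℝ), (∀ j, θ j ∈ Set.Icc L U) →
        rlin (θ ∘ i.succAbove) ≤ r' i (θ ∘ i.succAbove)) ∧
      (∃ (i : Fin (n+1)) (θ : Fin (n+1) → ℝ), (∀ j, θ j ∈ Set.Icc L U) ∧
        rlin (θ ∘ i.succAbove) < r' i (θ ∘ i.succAbove))) :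
    ∃ k ≤ n + 1, 0 ≤ Sl n m L U a k ∧ ∀ s ≤ n + 1, s ≠ k → Sl n m L U a s = 0 := by
  classical
  have hS := Sl_nonneg hmn hLU a rlin hrlin hnd
  have huniq : ∀ p q, p < q → q ≤ n + 1 → 0 < Sl n m L U a p → 0 < Sl n m L U a q → False := by
    intro p q hpq hq hp0 hq0
    obtain ⟨ε, hε, x, hx, hθ⟩ := tight_pair hmn hLU a rlin hrlin hS p q hpq hq hp0 hq0
    apply hundom
    refine ⟨fun i y => rlin y + if i = 0 ∧ y = x then ε else 0, ?_, ?_, ?_⟩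
    · intro θ h
      have : ∑ i : Fin (n+1), (if i = 0 ∧ θ ∘ i.succAbove = x then ε else 0) =
          if θ ∘ (0 : Fin (n+1)).succAbove = x then ε else 0 := by
        rw [Finset.sum_eq_single 0]
        · simp only [true_and]
        · intro b _ hb; simp [hb]
        · simp
      rw [Finset.sum_add_distrib, this]
      split_ifs with hc
      · exact hθ θ h hc
      · simpa using hnd θ h
    · intro i θ _
      dsimp only
      split_ifs <;> linarith
    · refine ⟨0, Fin.cons L x, ?_, ?_⟩
      · intro j
        refine Fin.cases ?_ ?_ j
        · exact ⟨le_rfl, hLU.le⟩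
        · intro j; simpa using hx j
      · have : (Fin.cons L x : Fin (n+1) → ℝ) ∘ (0 : Fin (n+1)).succAbove = x := by
          funext j; simp
        simp only [this]
        simpa using hε
  by_cases h : ∃ k ≤ n + 1, 0 < Sl n m L U a k
  · obtain ⟨k, hk, hk0⟩ := h
    refine ⟨k, hk, hS k, fun s hs hsk => ?_⟩
    by_contra hne
    have hs0 := lt_of_le_of_ne (hS s) (Ne.symm hne)
    rcases lt_or_gt_of_ne hsk with h | h
    · exact huniq s k h hk hs0 hk0
    · exact huniq k s h hs hk0 hs0
  · push Not at h
    exact ⟨0, by omega, hS 0, fun s hs _ => le_antisymm (h s hs) (hS s)⟩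

lemma Fsum_diff (n : ℕ) (a : ℕ → ℝ) (L U : ℝ) (s : ℕ) (hs : s ≤ n) :
    Fsum n a (fun j => if j < s + 1 then U else L) - Fsum n a (fun j => if j < s then U else L)
      = (U - L) * ((n - s) * a (s+1) + s * a s) := by
  have hv : ∀ j : ℕ, (if j < s + 1 then U else L) = (if j < s then U else L) +
      if j = s then U - L else 0 := by
    intro j
    rcases lt_trichotomy j s with h | h | h
    · rw [if_pos (by omega), if_pos h, if_neg (by omega)]; ring
    · rw [if_pos (by omega), if_neg (by omega), if_pos h]; ring
    · rw [if_neg (by omega), if_neg (by omega), if_neg (by omega)]; ring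
  unfold Fsum
  rw [add_sub_add_left_eq_sub, ← Finset.sum_sub_distrib]
  have : ∀ j ∈ Finset.range n, a (j+1) * ((j+1) * (if j + 1 < s + 1 then U else L) +
      (n - j) * (if j < s + 1 then U else L)) - a (j+1) * ((j+1) * (if j + 1 < s then U else L) +
      (n - j) * (if j < s then U else L)) =
      (if j + 1 = s then a s * s * (U - L) else 0) +
        (if j = s then a (s+1) * (n - s) * (U-L) else 0) := by
    intro j _
    rw [hv, hv]
    split_ifs with h1 h2
    all_goals first | omega | skip
    all_goals subst_vars
    all_goals push_cast
    all_goals ring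
  rw [Finset.sum_congr rfl this, Finset.sum_add_distrib, Finset.sum_ite_eq']
  have e1 : (if s ∈ Finset.range n then a (s+1) * (n - s) * (U-L) else 0) =
      a (s+1) * (n - s) * (U-L) := by
    split_ifs with h
    · rfl
    · obtain rfl : s = n := by rw [Finset.mem_range] at h; omega
      simp
  have e2 : ∑ j ∈ Finset.range n, (if j + 1 = s then a s * s * (U - L) else 0) =
      a s * s * (U - L) := by
    rcases s with _ | t
    · simp
    · simp only [Nat.add_right_cancel_iff, Finset.sum_ite_eq', Finset.mem_range]
      rw [if_pos (by omega)]
  rw [e1, e2]; ring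

lemma Sl_diff (n m : ℕ) (a : ℕ → ℝ) (L U : ℝ) (s : ℕ) (hs : s ≤ n) :
    Sl n m L U a (s+1) - Sl n m L U a s =
      (U - L) * ((if s = m then (m:ℝ) else 0) - ((n - s) * a (s+1) + s * a s)) := by
  have h := Fsum_diff n a L U s hs
  unfold Sl
  have : (m:ℝ) * (if m < s + 1 then U else L) - m * (if m < s then U else L) =
      (U - L) * (if s = m then (m:ℝ) else 0) := by
    rcases lt_trichotomy m s with h | h | h
    · rw [if_pos (by omega), if_pos h, if_neg (by omega)]; ring
    · rw [if_pos (by omega), if_neg (by omega), if_pos h.symm]; ring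
    · rw [if_neg (by omega), if_neg (by omega), if_neg (by omega)]; ring
  linarith

lemma Fsum_const (n : ℕ) (a : ℕ → ℝ) (c : ℝ) :
    Fsum n a (fun _ => c) = (n+1) * (a 0 + c * ∑ i ∈ Finset.Icc 1 n, a i) := by
  have : ∑ i ∈ Finset.Icc 1 n, a i = ∑ j ∈ Finset.range n, a (j+1) := by
    rw [Finset.range_eq_Ico, Finset.sum_Ico_add' a 0 n 1]
    rfl
  rw [this, mul_add, Finset.mul_sum, Finset.mul_sum]
  unfold Fsum
  congr 1
  exact Finset.sum_congr rfl fun j _ => by ring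

lemma Sl_zero (n m : ℕ) (a : ℕ → ℝ) (L U : ℝ) :
    Sl n m L U a 0 = m * L - (n+1) * (a 0 + L * ∑ i ∈ Finset.Icc 1 n, a i) := by
  rw [← Fsum_const]; simp [Sl]

lemma Sl_last (n m : ℕ) (hmn : m ≤ n) (a : ℕ → ℝ) (L U : ℝ) :
    Sl n m L U a (n+1) = m * U - (n+1) * (a 0 + U * ∑ i ∈ Finset.Icc 1 n, a i) := by
  rw [← Fsum_const]
  unfold Sl
  rw [if_pos (by omega)]
  congr 1
  unfold Fsum
  congr 1
  refine Finset.sum_congr rfl fun j hj => ?_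
  rw [Finset.mem_range] at hj
  dsimp only
  rw [if_pos (by omega), if_pos (by omega)]

lemma parity (n m k : ℕ) (hm : 1 ≤ m) (hmn : m ≤ n) (hk : k ≤ n + 1) (L U : ℝ) (hLU : L < U)
    (a : ℕ → ℝ) (hk0 : 0 ≤ Sl n m L U a k)
    (hS : ∀ s ≤ n + 1, s ≠ k → Sl n m L U a s = 0) : Odd (k + m) := by
  have h1 : ∑ s ∈ Finset.range (n+1), (-1:ℝ)^s * n.choose s * ((n - s) * a (s+1) + s * a s) = 0 := by
    have : ∀ s ∈ Finset.range (n+1), (-1:ℝ)^s * n.choose s * ((n - s) * a (s+1) + s * a s) =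
        (-1:ℝ)^s * n.choose s * s * a s - (-1:ℝ)^(s+1) * n.choose (s+1) * (s+1 : ℕ) * a (s+1) := by
      intro s hs
      have hs' : s ≤ n := by rw [Finset.mem_range] at hs; omega
      have e := Nat.choose_succ_right_eq n s
      have e' : (n.choose (s+1) : ℝ) * (s+1 : ℕ) = n.choose s * (n - s) := by
        rw [← Nat.cast_sub hs']; exact_mod_cast e
      rw [mul_assoc ((-1:ℝ)^(s+1)), e']
      ring
    rw [Finset.sum_congr rfl this,
      Finset.sum_range_sub' (fun s => (-1:ℝ)^s * n.choose s * (s:ℕ) * a s)]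
    simp
  have h2 : ∑ s ∈ Finset.range (n+1), (-1:ℝ)^s * n.choose s *
      (Sl n m L U a (s+1) - Sl n m L U a s) = (U - L) * ((-1)^m * n.choose m * m) := by
    have : ∀ s ∈ Finset.range (n+1), (-1:ℝ)^s * n.choose s *
        (Sl n m L U a (s+1) - Sl n m L U a s) =
        (if s = m then (U - L) * ((-1)^m * n.choose m * m) else 0) -
          (U - L) * ((-1:ℝ)^s * n.choose s * ((n - s) * a (s+1) + s * a s)) := by
      intro s hs
      rw [Sl_diff n m a L U s (by rw [Finset.mem_range] at hs; omega)]
      split_ifs with h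
      · subst h; ring
      · ring
    rw [Finset.sum_congr rfl this, Finset.sum_sub_distrib, ← Finset.mul_sum, h1,
      Finset.sum_ite_eq', if_pos (by rw [Finset.mem_range]; omega)]
    ring
  have h3 : ∑ s ∈ Finset.range (n+1), (-1:ℝ)^s * n.choose s *
      (Sl n m L U a (s+1) - Sl n m L U a s) =
      (-1)^(k+1) * (n+1).choose k * Sl n m L U a k := by
    have hS' : ∀ s ≤ n + 1, Sl n m L U a s = if s = k then Sl n m L U a k else 0 := by
      intro s hs
      split_ifs with h
      · rw [h]
      · exact hS s hs h
    have : ∀ s ∈ Finset.range (n+1), (-1:ℝ)^s * n.choose s *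
        (Sl n m L U a (s+1) - Sl n m L U a s) =
        (if s + 1 = k then (-1)^(k+1) * n.choose (k-1) * Sl n m L U a k else 0) -
          (if s = k then (-1)^k * n.choose k * Sl n m L U a k else 0) := by
      intro s hs
      rw [Finset.mem_range] at hs
      rw [hS' s (by omega), hS' (s+1) (by omega)]
      split_ifs with h1 h2
      · omega
      · subst h1; rw [Nat.add_sub_cancel]; ring
      · subst_vars; ring
      · ring
    rw [Finset.sum_congr rfl this, Finset.sum_sub_distrib, Finset.sum_ite_eq']
    have e1 : (if k ∈ Finset.range (n+1) then (-1:ℝ)^k * n.choose k * Sl n m L U a k else 0) =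
      (-1:ℝ)^k * n.choose k * Sl n m L U a k := by
      split_ifs with h
      · rfl
      · obtain rfl : k = n + 1 := by rw [Finset.mem_range] at h; omega
        simp
    rw [e1]
    rcases k with _ | t
    · simp
    · simp only [Nat.add_right_cancel_iff, Finset.sum_ite_eq', Finset.mem_range]
      rw [if_pos (by omega), Nat.choose_succ_succ]
      simp only [Nat.add_sub_cancel]
      push_cast
      ring
  rw [h3] at h2
  by_contra hodd
  rw [Nat.not_odd_iff_even] at hodd
  have hpos : 0 < (U - L) * (n.choose m * m : ℝ) := by
    have : 0 < n.choose m := Nat.choose_pos hmn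
    have hm' : (0:ℝ) < m := by exact_mod_cast hm
    have : (0:ℝ) < n.choose m := by exact_mod_cast this
    have : 0 < U - L := by linarith
    positivity
  have hnn : 0 ≤ ((n+1).choose k : ℝ) * Sl n m L U a k := by positivity
  have hkm : (-1:ℝ)^k * (-1)^m = 1 := by rw [← pow_add]; exact hodd.neg_one_pow
  have hmm : (-1:ℝ)^m * (-1)^m = 1 := by rw [← pow_add]; exact (Even.add_self m).neg_one_pow
  have := congrArg (fun z => (-1:ℝ)^m * z) h2
  have l : (-1:ℝ)^m * ((-1)^(k+1) * (n+1).choose k * Sl n m L U a k) =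
    - ((-1:ℝ)^k * (-1)^m) * (((n+1).choose k : ℝ) * Sl n m L U a k) := by ring
  have r : (-1:ℝ)^m * ((U - L) * ((-1)^m * n.choose m * m)) =
    ((-1:ℝ)^m * (-1)^m) * ((U - L) * (n.choose m * m : ℝ)) := by ring
  rw [l, r, hkm, hmm] at this
  linarith

lemma oelA_self (n m : ℕ) (hmn : m ≤ n) : oelA (n+1) m m = 1 := by
  simp [oelA, show n + 1 - m - 1 = n - m by omega]

lemma oelA_rec (n m s : ℕ) (hs : 1 ≤ s) (hsm : s < m) (hmn : m ≤ n) :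
    (s:ℝ) * oelA (n+1) m s = - ((n - s) * oelA (n+1) m (s+1)) := by
  obtain ⟨t, rfl⟩ : ∃ t, s = t + 1 := ⟨s - 1, by omega⟩
  obtain ⟨d, rfl⟩ : ∃ d, m = t + 1 + 1 + d := ⟨m - (t+1+1), by omega⟩
  obtain ⟨e, rfl⟩ : ∃ e, n = t + 1 + 1 + d + e := ⟨n - (t + 1 + 1 + d), by omega⟩
  unfold oelA
  rw [show t + 1 + 1 + d - (t + 1) = d + 1 by omega, show t + 1 + 1 + d - (t + 1 + 1) = d by omega,
    show t + 1 + 1 + d + e + 1 - (t + 1) - 1 = d + e + 1 by omega,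
    show t + 1 + 1 + d + e + 1 - (t + 1 + 1) - 1 = d + e by omega,
    show t + 1 + 1 + d + e + 1 - (t + 1 + 1 + d) - 1 = e by omega,
    show t + 1 + 1 + d - 1 = t + 1 + d by omega,
    show t + 1 - 1 = t by omega, show t + 1 + 1 - 1 = t + 1 by omega]
  have h1 := Nat.choose_mul_succ_eq (d+e) e
  rw [show d + e + 1 - e = d + 1 by omega] at h1
  have h2 := Nat.choose_succ_right_eq (t+1+d) t
  rw [show t + 1 + d - t = d + 1 by omega] at h2
  have p1 : (0:ℝ) < ((t+1+d).choose t : ℕ) := by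
    exact_mod_cast Nat.choose_pos (by omega)
  have p2 : (0:ℝ) < ((t+1+d).choose (t+1) : ℕ) := by
    exact_mod_cast Nat.choose_pos (by omega)
  have h1' : ((d+e).choose e : ℝ) * (d+e+1) = (d+e+1).choose e * (d+1) := by exact_mod_cast h1
  have h2' : ((t+1+d).choose (t+1) : ℝ) * (t+1) = (t+1+d).choose t * (d+1) := by exact_mod_cast h2
  generalize ((t+1+d).choose t : ℝ) = B1 at *
  generalize ((t+1+d).choose (t+1) : ℝ) = B2 at *
  generalize ((d+e).choose e : ℝ) = A2 at *
  generalize ((d+e+1).choose e : ℝ) = A1 at *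
  push_cast
  rw [pow_succ]
  field_simp
  linear_combination (-A1) * h2' + B1 * h1'

lemma oelB_base (n m : ℕ) (hm : 1 ≤ m) (hmn : m < n) :
    ((n:ℝ) - m) * oelB (n+1) m (m+1) = m := by
  obtain ⟨q, rfl⟩ : ∃ q, m = q + 1 := ⟨m - 1, by omega⟩
  obtain ⟨e, rfl⟩ : ∃ e, n = q + 1 + 1 + e := ⟨n - (q+1+1), by omega⟩
  unfold oelB
  rw [show q + 1 + 1 - (q+1) - 1 = 0 by omega, show q + 1 + 1 - 1 = q + 1 by omega,
    show q + 1 - 1 = q by omega, show q + 1 + 1 + e + 1 - (q + 1) - 1 = e + 1 by omega,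
    show q + 1 + 1 + e + 1 - (q + 1 + 1) - 1 = e by omega]
  rw [Nat.choose_succ_self_right, Nat.choose_succ_self_right]
  push_cast
  have : (e:ℝ) + 1 ≠ 0 := by positivity
  field_simp
  ring

lemma oelB_rec (n m s : ℕ) (hm : 1 ≤ m) (hms : m < s) (hsn : s < n) :
    ((n:ℝ) - s) * oelB (n+1) m (s+1) = - (s * oelB (n+1) m s) := by
  obtain ⟨q, rfl⟩ : ∃ q, m = q + 1 := ⟨m - 1, by omega⟩
  obtain ⟨d, rfl⟩ : ∃ d, s = q + 2 + d := ⟨s - (q+2), by omega⟩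
  obtain ⟨e, rfl⟩ : ∃ e, n = q + 2 + d + 1 + e := ⟨n - (q + 2 + d + 1), by omega⟩
  unfold oelB
  rw [show q + 2 + d + 1 - (q + 1) - 1 = d + 1 by omega,
    show q + 2 + d - (q + 1) - 1 = d by omega,
    show q + 2 + d + 1 - 1 = q + 1 + d + 1 by omega, show q + 2 + d - 1 = q + 1 + d by omega,
    show q + 1 - 1 = q by omega,
    show q + 2 + d + 1 + e + 1 - (q + 1) - 1 = d + 2 + e by omega,
    show q + 2 + d + 1 + e + 1 - (q + 2 + d + 1) - 1 = e by omega,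
    show q + 2 + d + 1 + e + 1 - (q + 2 + d) - 1 = e + 1 by omega]
  have h1 := Nat.choose_mul_succ_eq (q+1+d) q
  rw [show q + 1 + d + 1 - q = d + 2 by omega] at h1
  have h2 := Nat.choose_succ_right_eq (d+2+e) e
  rw [show d + 2 + e - e = d + 2 by omega] at h2
  have p1 : (0:ℝ) < ((d+2+e).choose e : ℕ) := by
    exact_mod_cast Nat.choose_pos (by omega)
  have p2 : (0:ℝ) < ((d+2+e).choose (e+1) : ℕ) := by
    exact_mod_cast Nat.choose_pos (by omega)
  have h1' : ((q+1+d).choose q : ℝ) * (q+1+d+1) = (q+1+d+1).choose q * (d+2) := by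
    exact_mod_cast h1
  have h2' : ((d+2+e).choose (e+1) : ℝ) * (e+1) = (d+2+e).choose e * (d+2) := by
    exact_mod_cast h2
  generalize ((d+2+e).choose e : ℝ) = B1 at *
  generalize ((d+2+e).choose (e+1) : ℝ) = B2 at *
  generalize ((q+1+d).choose q : ℝ) = A2 at *
  generalize ((q+1+d+1).choose q : ℝ) = A1 at *
  push_cast
  rw [pow_succ]
  field_simp
  linear_combination (-A1) * h2' + B1 * h1'

lemma coeffs (n m k : ℕ) (hm : 1 ≤ m) (hmn : m ≤ n) (hk : k ≤ n + 1) (L U : ℝ) (hLU : L < U)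
    (a : ℕ → ℝ) (hS : ∀ s ≤ n + 1, s ≠ k → Sl n m L U a s = 0) :
    ∀ i ≤ n, a i = oelCoeff (n+1) m k L U i := by
  have hUL : U - L ≠ 0 := by linarith
  have hn0 : (n:ℝ) + 1 ≠ 0 := by positivity
  have hR : ∀ s ≤ n, s ≠ k → s + 1 ≠ k →
      ((n:ℝ) - s) * a (s+1) + s * a s = if s = m then (m:ℝ) else 0 := by
    intro s hs h1 h2
    have h := Sl_diff n m a L U s hs
    rw [hS s (by omega) h1, hS (s+1) (by omega) h2, sub_zero, eq_comm, mul_eq_zero] at h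
    rcases h with h | h
    · exact absurd h hUL
    · linarith
  have upz : ∀ j, j + 1 ≤ m → j + 1 < k → a (j+1) = 0 := by
    intro j
    induction j with
    | zero =>
      intro h1 h2
      have h := hR 0 (by omega) (by omega) (by omega)
      rw [if_neg (by omega)] at h
      have : (n:ℝ) ≠ 0 := by norm_cast; omega
      simp only [Nat.cast_zero, sub_zero, zero_mul, add_zero, mul_eq_zero] at h
      exact h.resolve_left this
    | succ j ih =>
      intro h1 h2
      have h := hR (j+1) (by omega) (by omega) (by omega)
      rw [if_neg (by omega), ih (by omega) (by omega)] at h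
      have : (n:ℝ) - (j+1 : ℕ) ≠ 0 := by
        rw [sub_ne_zero]; norm_cast; omega
      simp only [mul_zero, add_zero, mul_eq_zero] at h
      exact h.resolve_left this
  have upB : ∀ d, m + 1 + d < k → m + 1 + d ≤ n → a (m+1+d) = oelB (n+1) m (m+1+d) := by
    intro d
    induction d with
    | zero =>
      intro h1 h2
      have h := hR m (by omega) (by omega) (by omega)
      have hz : a m = 0 := by
        obtain ⟨j, rfl⟩ : ∃ j, m = j + 1 := ⟨m - 1, by omega⟩
        exact upz j le_rfl (by omega)
      rw [if_pos rfl, hz, mul_zero, add_zero] at h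
      have : (n:ℝ) - m ≠ 0 := by
        rw [sub_ne_zero]; norm_cast; omega
      exact mul_left_cancel₀ this (h.trans (oelB_base n m hm (by omega)).symm)
    | succ d ih =>
      intro h1 h2
      have h := hR (m+1+d) (by omega) (by omega) (by omega)
      rw [if_neg (by omega), ih (by omega) (by omega)] at h
      have h' := oelB_rec n m (m+1+d) hm (by omega) (by omega)
      have : (n:ℝ) - (m+1+d : ℕ) ≠ 0 := by
        rw [sub_ne_zero]; norm_cast; omega
      apply mul_left_cancel₀ this
      rw [← add_assoc]
      linarith
  have upB' : ∀ j, m + 1 ≤ j → j < k → j ≤ n → a j = oelB (n+1) m j := by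
    intro j h1 h2 h3
    obtain ⟨d, rfl⟩ : ∃ d, j = m + 1 + d := ⟨j - (m+1), by omega⟩
    exact upB d h2 h3
  have upz' : ∀ j, 1 ≤ j → j < k → j ≤ m → a j = 0 := by
    intro j h1 h2 h3
    obtain ⟨d, rfl⟩ : ∃ d, j = d + 1 := ⟨j - 1, by omega⟩
    exact upz d h3 h2
  have dnz : ∀ d j, j + d = n → k < j → m < j → a j = 0 := by
    intro d
    induction d with
    | zero =>
      intro j h1 h2 h3
      have h := hR j (by omega) (by omega) (by omega)
      have hj : (j:ℝ) ≠ 0 := by norm_cast; omega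
      have e : (n:ℝ) - j = 0 := by rw [← h1]; simp
      rw [if_neg (by omega), e, zero_mul, zero_add, mul_eq_zero] at h
      exact h.resolve_left hj
    | succ d ih =>
      intro j h1 h2 h3
      have h := hR j (by omega) (by omega) (by omega)
      have hj : (j:ℝ) ≠ 0 := by norm_cast; omega
      rw [if_neg (by omega), ih (j+1) (by omega) (by omega) (by omega), mul_zero, zero_add,
        mul_eq_zero] at h
      exact h.resolve_left hj
  have dnA : ∀ d j, j + d = m → k < j → a j = oelA (n+1) m j := by
    intro d
    induction d with
    | zero =>
      intro j h1 h2
      obtain rfl : j = m := by omega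
      have h := hR j (by omega) (by omega) (by omega)
      have hj : (j:ℝ) ≠ 0 := by norm_cast; omega
      have e : ((n:ℝ) - j) * a (j+1) = 0 := by
        rcases Nat.lt_or_ge j n with h' | h'
        · rw [dnz (n - (j+1)) (j+1) (by omega) (by omega) (by omega), mul_zero]
        · obtain rfl : j = n := by omega
          simp
      rw [if_pos rfl, e, zero_add] at h
      rw [oelA_self n j hmn]
      apply mul_left_cancel₀ hj
      linarith
    | succ d ih =>
      intro j h1 h2
      have h := hR j (by omega) (by omega) (by omega)
      have hj : (j:ℝ) ≠ 0 := by norm_cast; omega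
      rw [if_neg (by omega), ih (j+1) (by omega) (by omega)] at h
      have h' := oelA_rec n m j (by omega) (by omega) hmn
      apply mul_left_cancel₀ hj
      linarith
  have dnz' : ∀ j, k < j → m < j → j ≤ n → a j = 0 := fun j h1 h2 h3 =>
    dnz (n - j) j (by omega) h1 h2
  have dnA' : ∀ j, k < j → j ≤ m → a j = oelA (n+1) m j := fun j h1 h2 =>
    dnA (m - j) j (by omega) h1
  -- boundary conditions
  have hB0 : k ≠ 0 → (n+1) * (a 0 + L * ∑ i ∈ Finset.Icc 1 n, a i) = m * L := by
    intro h
    have := Sl_zero n m a L U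
    rw [hS 0 (by omega) (Ne.symm h)] at this
    linarith
  have hBN : k ≠ n + 1 → (n+1) * (a 0 + U * ∑ i ∈ Finset.Icc 1 n, a i) = m * U := by
    intro h
    have := Sl_last n m hmn a L U
    rw [hS (n+1) (by omega) (Ne.symm h)] at this
    linarith
  have hmid : k ≠ 0 → k ≠ n + 1 → a 0 = 0 ∧ ∑ i ∈ Finset.Icc 1 n, a i = m / (n+1) := by
    intro h1 h2
    have e1 := hB0 h1
    have e2 := hBN h2
    have e3 : (U - L) * ((n+1) * ∑ i ∈ Finset.Icc 1 n, a i) = (U - L) * m := by linarith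
    have e4 := mul_left_cancel₀ hUL e3
    have e5 : ((n:ℝ)+1) * a 0 = 0 := by linear_combination e1 - L * e4
    refine ⟨(mul_eq_zero.mp e5).resolve_left hn0, ?_⟩
    rw [eq_div_iff hn0]; linarith
  intro i hi
  unfold oelCoeff
  rw [show n + 1 - 1 = n by omega]
  split_ifs with c1 c2 c3 c4 c5 c6 c7 c8 c9 c10 c11
  · subst c1 c2
    have hs : ∑ i ∈ Finset.Icc 1 n, a i = ∑ j ∈ Finset.Icc 1 m, oelA (n+1) m j := by
      rw [← Finset.sum_subset (Finset.Icc_subset_Icc_right hmn)]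
      · exact Finset.sum_congr rfl fun j hj => by
          rw [Finset.mem_Icc] at hj
          exact dnA' j (by omega) hj.2
      · intro j hj hj'
        rw [Finset.mem_Icc] at hj hj'
        exact dnz' j (by omega) (by omega) hj.2
    have := hBN (by omega)
    rw [hs] at this
    push_cast
    field_simp
    linarith
  · exact dnA' i (by omega) c3
  · exact dnz' i (by omega) (by omega) hi
  · subst c5
    have hs : ∑ j ∈ Finset.Icc 1 n, a j = a i + ∑ j ∈ Finset.Icc (i+1) m, oelA (n+1) m j := by
      have : ∑ j ∈ Finset.Icc (i+1) m, oelA (n+1) m j = ∑ j ∈ Finset.Icc (i+1) m, a j :=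
        Finset.sum_congr rfl fun j hj => by
          rw [Finset.mem_Icc] at hj
          exact (dnA' j (by omega) hj.2).symm
      rw [this, ← Finset.sum_insert (by simp)]
      symm
      apply Finset.sum_subset
      · intro j hj
        rw [Finset.mem_insert, Finset.mem_Icc] at hj
        rw [Finset.mem_Icc]; omega
      · intro j hj hj'
        rw [Finset.mem_Icc] at hj
        rw [Finset.mem_insert, Finset.mem_Icc] at hj'
        rcases Nat.lt_or_ge j i with h | h
        · exact upz' j (by omega) h (by omega)
        · exact dnz' j (by omega) (by omega) hj.2
    have := (hmid (by omega) (by omega)).2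
    push_cast
    linarith
  · exact dnA' i (by omega) (by omega)
  · rcases Nat.eq_zero_or_pos i with h0 | h0
    · rw [h0]; exact (hmid (by omega) (by omega)).1
    rcases Nat.lt_or_ge i k with h | h
    · exact upz' i (by omega) h (by omega)
    · exact dnz' i (by omega) (by omega) hi
  · subst c8
    have hs : ∑ j ∈ Finset.Icc 1 n, a j = a i + ∑ j ∈ Finset.Icc (m+1) (i-1), oelB (n+1) m j := by
      have : ∑ j ∈ Finset.Icc (m+1) (i-1), oelB (n+1) m j = ∑ j ∈ Finset.Icc (m+1) (i-1), a j :=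
        Finset.sum_congr rfl fun j hj => by
          rw [Finset.mem_Icc] at hj
          exact (upB' j (by omega) (by omega) (by omega)).symm
      rw [this, ← Finset.sum_insert (by rw [Finset.mem_Icc]; omega)]
      symm
      apply Finset.sum_subset
      · intro j hj
        rw [Finset.mem_insert, Finset.mem_Icc] at hj
        rw [Finset.mem_Icc]; omega
      · intro j hj hj'
        rw [Finset.mem_Icc] at hj
        rw [Finset.mem_insert, Finset.mem_Icc] at hj'
        rcases Nat.lt_or_ge j i with h | h
        · exact upz' j (by omega) h (by omega)
        · exact dnz' j (by omega) (by omega) hj.2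
    have := (hmid (by omega) (by omega)).2
    push_cast
    linarith
  · exact upB' i (by omega) (by omega) hi
  · rcases Nat.eq_zero_or_pos i with h0 | h0
    · rw [h0]; exact (hmid (by omega) (by omega)).1
    rcases Nat.lt_or_ge i k with h | h
    · exact upz' i (by omega) h (by omega)
    · exact dnz' i (by omega) (by omega) hi
  · obtain rfl : k = n + 1 := by omega
    have hs : ∑ i ∈ Finset.Icc 1 n, a i = ∑ j ∈ Finset.Icc (m+1) n, oelB (n+1) m j := by
      rw [← Finset.sum_subset (Finset.Icc_subset_Icc_left (show 1 ≤ m + 1 by omega))]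
      · exact Finset.sum_congr rfl fun j hj => by
          rw [Finset.mem_Icc] at hj
          exact upB' j (by omega) (by omega) hj.2
      · intro j hj hj'
        rw [Finset.mem_Icc] at hj hj'
        exact upz' j (by omega) (by omega) (by omega)
    have := hB0 (by omega)
    rw [hs] at this
    rw [c10]
    push_cast
    field_simp
    linarith
  · exact upB' i (by omega) (by omega) hi
  · exact upz' i (by omega) (by omega) (by omega)

theorem stmt_13 {n m : ℕ} (hn : 1 ≤ n) (hm : 1 ≤ m) (hmn : m ≤ n)
    {L U : ℝ} (hL : 0 ≤ L) (hLU : L < U)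
    (a : ℕ → ℝ)
    (rlin : (Fin n → ℝ) → ℝ)
    (hrlin : ∀ x : Fin n → ℝ,
      rlin x = a 0 + ∑ j : Fin n, a (j.1 + 1) * kthTop x j)
    -- the anonymous linear mechanism is non-deficit
    (hnd : ∀ θ : Fin (n+1) → ℝ, (∀ i, θ i ∈ Set.Icc L U) →
      ∑ i : Fin (n+1), rlin (θ ∘ i.succAbove) ≤ m * kthTop θ ⟨m, by omega⟩)
    -- it is individually undominated among non-deficit Groves mechanisms
    (hundom : ¬ ∃ r' : Fin (n+1) → (Fin n → ℝ) → ℝ,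
      (∀ θ : Fin (n+1) → ℝ, (∀ i, θ i ∈ Set.Icc L U) →
        ∑ i : Fin (n+1), r' i (θ ∘ i.succAbove) ≤ m * kthTop θ ⟨m, by omega⟩) ∧
      (∀ (i : Fin (n+1)) (θ : Fin (n+1) → ℝ), (∀ j, θ j ∈ Set.Icc L U) →
        rlin (θ ∘ i.succAbove) ≤ r' i (θ ∘ i.succAbove)) ∧
      (∃ (i : Fin (n+1)) (θ : Fin (n+1) → ℝ), (∀ j, θ j ∈ Set.Icc L U) ∧
        rlin (θ ∘ i.succAbove) < r' i (θ ∘ i.succAbove))) :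
    ∃ k : ℕ, k ≤ n + 1 ∧ Odd (k + m) ∧
      ∀ i ≤ n, a i = oelCoeff (n+1) m k L U i := by
  obtain ⟨k, hk, hk0, hS⟩ := tight_except hmn hLU a rlin hrlin hnd hundom
  exact ⟨k, hk, parity n m k hm hmn hk L U hLU a hk0 hS, coeffs n m k hm hmn hk L U hLU a hS⟩
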